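/- arXiv:1103.5859 — 2 statements merged into one kernel-verified Lean document; each statement's English description precedes it below -/
import Mathlib

section
/- Let E and T be nonempty types, 𝒞 = ℓ∞(E × T) and 𝒳 = ℓ∞(E). Let A be a bounded linear operator on 𝒳, let b, d : E × T → ℝ be bounded functions, and let l be a nonzero real number. Set W := l·Id + A, m := inf_{(x,t)} |l − d(x,t)/b(x,t)| and λ := ‖W‖/m, and assume inf |b| > 0, m > 0 and λ < 1. Then with e_{N}(x,t) := 1/(l − d(x,t)/b(x,t))^{N}, the remainder operators satisfy ‖ (W^{N+1})~ ∘ M_{e_{N+1}} ‖ ≤ λ^{N+1} for all N, and consequently for every X ∈ 𝒞 one has (W^{N+1})~ ( M_{e_{N+1}} X ) → 0 in 𝒞 as N → ∞. -/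
open scoped ENNReal

open Filter

theorem exists_lp_slice {E T : Type*} (X : lp (fun _ : E × T => ℝ) ∞) (t : T) :
    ∃ Y : lp (fun _ : E => ℝ) ∞, (∀ x, Y x = X (x, t)) ∧ ‖Y‖ ≤ ‖X‖ := by
  have hX (x : E) : ‖X (x, t)‖ ≤ ‖X‖ := lp.norm_apply_le_norm ENNReal.top_ne_zero X (x, t)
  have hmem : Memℓp (fun x : E => X (x, t)) ∞ :=
    memℓp_infty ⟨‖X‖, by rintro _ ⟨x, rfl⟩; exact hX x⟩
  exact ⟨⟨_, hmem⟩, fun _ => rfl, lp.norm_le_of_forall_le (norm_nonneg X) hX⟩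

/-- A slicewise lift of `B` has operator norm at most `‖B‖`. -/
theorem norm_le_of_slicewise {E T : Type*}
    (B : lp (fun _ : E => ℝ) ∞ →L[ℝ] lp (fun _ : E => ℝ) ∞)
    (L : lp (fun _ : E × T => ℝ) ∞ →L[ℝ] lp (fun _ : E × T => ℝ) ∞)
    (hL : ∀ (X : lp (fun _ : E × T => ℝ) ∞) (t : T) (Y : lp (fun _ : E => ℝ) ∞),
      (∀ x : E, Y x = X (x, t)) → ∀ x : E, L X (x, t) = B Y x) :
    ‖L‖ ≤ ‖B‖ := by
  refine L.opNorm_le_bound (norm_nonneg B) fun X =>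
    lp.norm_le_of_forall_le (by positivity) ?_
  rintro ⟨x, t⟩
  obtain ⟨Y, hY, hYX⟩ := exists_lp_slice X t
  rw [hL X t Y hY x]
  calc ‖B Y x‖ ≤ ‖B Y‖ := lp.norm_apply_le_norm ENNReal.top_ne_zero (B Y) x
    _ ≤ ‖B‖ * ‖Y‖ := B.le_opNorm Y
    _ ≤ ‖B‖ * ‖X‖ := by gcongr

/-- Multiplication by a function bounded by `C` has operator norm at most `C`. -/
theorem norm_le_of_apply_eq_mul {ι : Type*} (r : ι → ℝ) {C : ℝ} (hC : 0 ≤ C)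
    (hr : ∀ p, |r p| ≤ C) (M : lp (fun _ : ι => ℝ) ∞ →L[ℝ] lp (fun _ : ι => ℝ) ∞)
    (hM : ∀ (X : lp (fun _ : ι => ℝ) ∞) (p : ι), M X p = r p * X p) : ‖M‖ ≤ C := by
  refine M.opNorm_le_bound hC fun X =>
    lp.norm_le_of_forall_le (by positivity) fun p => ?_
  rw [hM, norm_mul]
  exact mul_le_mul (hr p) (lp.norm_apply_le_norm ENNReal.top_ne_zero X p) (norm_nonneg _) hC

/-- **Remainder estimate.** Under the spectral condition `λ = ‖W‖/m < 1`, the remainder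
operators satisfy `‖(W^{N+1})~ ∘ M_{e_{N+1}}‖ ≤ λ^{N+1}`, and consequently
`(W^{N+1})~ (M_{e_{N+1}} X) → 0` for every `X ∈ 𝒞`. -/
theorem remainder_tendsto_zero {E T : Type*} [Nonempty E] [Nonempty T]
    (A : lp (fun _ : E => ℝ) ∞ →L[ℝ] lp (fun _ : E => ℝ) ∞)
    (b d : E × T → ℝ)
    (hb_bdd : BddAbove (Set.range fun p : E × T => |b p|))
    (hd_bdd : BddAbove (Set.range fun p : E × T => |d p|))
    (l : ℝ) (hl : l ≠ 0)
    (W : lp (fun _ : E => ℝ) ∞ →L[ℝ] lp (fun _ : E => ℝ) ∞)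
    (hW : W = l • ContinuousLinearMap.id ℝ (lp (fun _ : E => ℝ) ∞) + A)
    (m lam : ℝ)
    (hm : m = ⨅ p : E × T, |l - d p / b p|)
    (hlam : lam = ‖W‖ / m)
    (hb_pos : 0 < ⨅ p : E × T, |b p|)
    (hm_pos : 0 < m) (hlam_lt : lam < 1)
    (liftWpow : ℕ → lp (fun _ : E × T => ℝ) ∞ →L[ℝ] lp (fun _ : E × T => ℝ) ∞)
    (hliftWpow : ∀ (k : ℕ) (X : lp (fun _ : E × T => ℝ) ∞) (t : T) (Y : lp (fun _ : E => ℝ) ∞),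
      (∀ x : E, Y x = X (x, t)) → ∀ x : E, liftWpow k X (x, t) = (W ^ k) Y x)
    (Me : ℕ → lp (fun _ : E × T => ℝ) ∞ →L[ℝ] lp (fun _ : E × T => ℝ) ∞)
    (hMe : ∀ (n : ℕ) (X : lp (fun _ : E × T => ℝ) ∞) (p : E × T),
      Me n X p = (1 / (l - d p / b p) ^ n) * X p) :
    (∀ N : ℕ, ‖(liftWpow (N + 1)).comp (Me (N + 1))‖ ≤ lam ^ (N + 1)) ∧
    ∀ X : lp (fun _ : E × T => ℝ) ∞,
      Tendsto (fun N : ℕ => liftWpow (N + 1) (Me (N + 1) X)) atTop (nhds 0) := by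
  have hm_le (p : E × T) : m ≤ |l - d p / b p| :=
    hm ▸ ciInf_le ⟨0, by rintro _ ⟨q, rfl⟩; exact abs_nonneg _⟩ p
  have hbound (N : ℕ) : ‖(liftWpow (N + 1)).comp (Me (N + 1))‖ ≤ lam ^ (N + 1) := by
    have hlift : ‖liftWpow (N + 1)‖ ≤ ‖W‖ ^ (N + 1) :=
      (norm_le_of_slicewise _ _ (hliftWpow (N + 1))).trans (norm_pow_le' W N.succ_pos)
    have hmul : ‖Me (N + 1)‖ ≤ 1 / m ^ (N + 1) := by
      refine norm_le_of_apply_eq_mul _ (by positivity) (fun p => ?_) _ (hMe (N + 1))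
      rw [abs_div, abs_one, abs_pow]
      gcongr
      exact hm_le p
    calc ‖(liftWpow (N + 1)).comp (Me (N + 1))‖
        ≤ ‖liftWpow (N + 1)‖ * ‖Me (N + 1)‖ := ContinuousLinearMap.opNorm_comp_le _ _
      _ ≤ ‖W‖ ^ (N + 1) * (1 / m ^ (N + 1)) := by gcongr
      _ = lam ^ (N + 1) := by rw [hlam, div_pow, mul_one_div]
  refine ⟨hbound, fun X => ?_⟩
  have hlam_nonneg : 0 ≤ lam := hlam ▸ by positivity
  have hpow : Tendsto (fun N : ℕ => lam ^ (N + 1) * ‖X‖) atTop (nhds 0) := by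
    simpa using ((tendsto_pow_atTop_nhds_zero_of_lt_one hlam_nonneg hlam_lt).comp
      (tendsto_add_atTop_nat 1)).mul_const ‖X‖
  exact squeeze_zero_norm
    (fun N => ContinuousLinearMap.le_of_opNorm_le _ (hbound N) X) hpow
end

section
/- Let n ∈ ℕ, let A be a continuous linear operator on ℝⁿ, let I : ℝ → ℝⁿ be continuous and bounded with M := sup_{t≥0} ‖I(t)‖, let X₀ ∈ ℝⁿ, and let l > 0 satisfy ‖W‖ < l where W := l·Id + A. Then for every k ∈ ℕ, sup_{t ≥ 0} ‖ W^k ( e^{−l t} (t^k/k!) · X₀ + ∫₀ᵗ e^{−l(t−s)} ((t−s)^k/k!) · I(s) ds ) ‖ ≤ (‖W‖/l)^k · ( ‖X₀‖ + M/l ); in particular, since ‖W‖/l < 1, the series of functions t ↦ W^k( e^{−l t}(t^k/k!)·X₀ + ∫₀ᵗ e^{−l(t−s)}((t−s)^k/k!)·I(s)ds ) is uniformly summable on [0,∞). -/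
open Filter

/-- The Erlang-type kernel `t ↦ exp (-l t) tᵏ / k!` is bounded by `1 / lᵏ` on `[0, ∞)`. -/
lemma exp_neg_mul_pow_div_factorial_le {l t : ℝ} (hl : 0 < l) (ht : 0 ≤ t) (k : ℕ) :
    Real.exp (-l * t) * (t ^ k / (k.factorial : ℝ)) ≤ 1 / l ^ k := by
  have h := Real.pow_div_factorial_le_exp (l * t) (by positivity) k
  have he : Real.exp (-l * t) * Real.exp (l * t) = 1 := by
    rw [← Real.exp_add]; simp
  rw [le_div_iff₀ (by positivity)]
  calc Real.exp (-l * t) * (t ^ k / (k.factorial : ℝ)) * l ^ k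
      = Real.exp (-l * t) * ((l * t) ^ k / (k.factorial : ℝ)) := by rw [mul_pow]; ring
    _ ≤ Real.exp (-l * t) * Real.exp (l * t) := by gcongr
    _ = 1 := he

lemma hasDerivAt_exp_neg_mul_pow_div_factorial (l u : ℝ) (k : ℕ) :
    HasDerivAt (fun t : ℝ => Real.exp (-l * t) * (t ^ (k + 1) / ((k + 1).factorial : ℝ)))
      (Real.exp (-l * u) * (u ^ k / (k.factorial : ℝ))
        - l * (Real.exp (-l * u) * (u ^ (k + 1) / ((k + 1).factorial : ℝ)))) u := by
  have h1 : HasDerivAt (fun t : ℝ => Real.exp (-l * t)) (Real.exp (-l * u) * (-l * 1)) u :=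
    ((hasDerivAt_id u).const_mul (-l)).exp
  have h2 := (hasDerivAt_pow (k + 1) u).div_const ((k + 1).factorial : ℝ)
  refine (h1.mul h2).congr_deriv ?_
  have : (k.factorial : ℝ) ≠ 0 := by positivity
  rw [Nat.factorial_succ]
  push_cast
  field_simp
  ring

lemma integral_exp_neg_mul_pow_div_factorial_le {l t : ℝ} (hl : 0 < l) (ht : 0 ≤ t) (k : ℕ) :
    ∫ u in (0 : ℝ)..t, Real.exp (-l * u) * (u ^ k / (k.factorial : ℝ)) ≤ 1 / l ^ (k + 1) := by
  induction k with
  | zero =>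
    have hd : ∀ u ∈ Set.uIcc 0 t,
        HasDerivAt (fun t : ℝ => -Real.exp (-l * t) / l) (Real.exp (-l * u)) u := fun u _ => by
      refine ((((hasDerivAt_id u).const_mul (-l)).exp.neg).div_const l).congr_deriv ?_
      simp only [id]
      field_simp
    have h := intervalIntegral.integral_eq_sub_of_hasDerivAt hd
      ((by fun_prop : Continuous fun u : ℝ => Real.exp (-l * u)).intervalIntegrable _ _)
    simp only [pow_zero, Nat.factorial_zero, Nat.cast_one, div_one, mul_one, zero_add, pow_one]
    rw [h]
    have : 0 < Real.exp (-l * t) / l := by positivity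
    simp only [mul_zero, Real.exp_zero, neg_div]
    linarith
  | succ k ih =>
    have hc : ∀ j : ℕ, IntervalIntegrable
        (fun u : ℝ => Real.exp (-l * u) * (u ^ j / (j.factorial : ℝ)))
        MeasureTheory.volume 0 t := fun j =>
      (by fun_prop : Continuous fun u : ℝ =>
        Real.exp (-l * u) * (u ^ j / (j.factorial : ℝ))).intervalIntegrable _ _
    have h := intervalIntegral.integral_eq_sub_of_hasDerivAt
      (fun u _ => hasDerivAt_exp_neg_mul_pow_div_factorial l u k)
      ((hc k).sub ((hc (k + 1)).const_mul l))
    rw [intervalIntegral.integral_sub (hc k) ((hc (k + 1)).const_mul l),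
      intervalIntegral.integral_const_mul] at h
    have h0 : 0 ≤ Real.exp (-l * t) * (t ^ (k + 1) / ((k + 1).factorial : ℝ)) := by positivity
    simp only [ne_eq, Nat.add_eq_zero_iff, one_ne_zero, and_false, not_false_eq_true, zero_pow,
      zero_div, mul_zero, sub_zero] at h
    rw [pow_succ l (k + 1), ← div_div, le_div_iff₀ hl]
    linarith

lemma norm_pow_apply_le {E : Type*} [NormedAddCommGroup E] [NormedSpace ℝ E] (W : E →L[ℝ] E)
    (k : ℕ) (v : E) : ‖(W ^ k) v‖ ≤ ‖W‖ ^ k * ‖v‖ := by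
  induction k with
  | zero => simp
  | succ k ih =>
    rw [pow_succ', mul_apply_eq_comp, pow_succ', mul_assoc]
    exact (W.le_opNorm _).trans (by gcongr)

lemma norm_integral_kernel_smul_le {E : Type*} [NormedAddCommGroup E] [NormedSpace ℝ E]
    {I : ℝ → E} {M l t : ℝ} (hM : ∀ s, 0 ≤ s → ‖I s‖ ≤ M) (hl : 0 < l)
    (ht : 0 ≤ t) (k : ℕ) :
    ‖∫ s in (0 : ℝ)..t,
        (Real.exp (-l * (t - s)) * ((t - s) ^ k / (k.factorial : ℝ))) • I s‖
      ≤ M / l ^ (k + 1) := by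
  have hM0 : 0 ≤ M := (norm_nonneg _).trans (hM 0 le_rfl)
  have hb := intervalIntegral.norm_integral_le_of_norm_le (μ := MeasureTheory.volume)
    (f := fun s => (Real.exp (-l * (t - s)) * ((t - s) ^ k / (k.factorial : ℝ))) • I s)
    (g := fun s => Real.exp (-l * (t - s)) * ((t - s) ^ k / (k.factorial : ℝ)) * M) ht
    (Eventually.of_forall fun s hs => by
      have hs' : 0 ≤ t - s := sub_nonneg.2 hs.2
      rw [norm_smul, Real.norm_of_nonneg (by positivity)]
      gcongr
      exact hM s hs.1.le)
    ((by fun_prop : Continuous fun s : ℝ =>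
      Real.exp (-l * (t - s)) * ((t - s) ^ k / (k.factorial : ℝ)) * M).intervalIntegrable _ _)
  refine hb.trans ?_
  rw [intervalIntegral.integral_mul_const, intervalIntegral.integral_comp_sub_left
    (fun u => Real.exp (-l * u) * (u ^ k / (k.factorial : ℝ))) t, sub_self, sub_zero]
  calc _ ≤ 1 / l ^ (k + 1) * M := by
        gcongr
        exact integral_exp_neg_mul_pow_div_factorial_le hl ht k
    _ = M / l ^ (k + 1) := by ring

/-- **Uniform summability of the series expansion** under the spectral condition
`‖W‖ < l` with `W = l·Id + A`: each term of the series is bounded in sup-norm on `[0,∞)`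
by `(‖W‖/l)ᵏ (‖X₀‖ + M/l)` where `M = sup_{t ≥ 0} ‖I(t)‖`, and since `‖W‖/l < 1` the
series of functions converges uniformly on `[0,∞)`. -/
theorem uniform_summability_series (n : ℕ)
    (A : EuclideanSpace ℝ (Fin n) →L[ℝ] EuclideanSpace ℝ (Fin n))
    (I : ℝ → EuclideanSpace ℝ (Fin n)) (hI : Continuous I)
    (M : ℝ)
    (hI_bdd : BddAbove (Set.range fun t : Set.Ici (0 : ℝ) => ‖I (t : ℝ)‖))
    (hM : M = ⨆ t : Set.Ici (0 : ℝ), ‖I (t : ℝ)‖)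
    (X₀ : EuclideanSpace ℝ (Fin n))
    (l : ℝ) (hl : 0 < l)
    (W : EuclideanSpace ℝ (Fin n) →L[ℝ] EuclideanSpace ℝ (Fin n))
    (hW : W = l • ContinuousLinearMap.id ℝ (EuclideanSpace ℝ (Fin n)) + A)
    (hWl : ‖W‖ < l) :
    (∀ (k : ℕ) (t : ℝ), 0 ≤ t →
      ‖(W ^ k) ((Real.exp (-l * t) * (t ^ k / (k.factorial : ℝ))) • X₀
          + ∫ s in (0 : ℝ)..t,
              (Real.exp (-l * (t - s)) * ((t - s) ^ k / (k.factorial : ℝ))) • I s)‖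
        ≤ (‖W‖ / l) ^ k * (‖X₀‖ + M / l)) ∧
    TendstoUniformlyOn
      (fun (N : ℕ) (t : ℝ) => ∑ k ∈ Finset.range N,
        (W ^ k) ((Real.exp (-l * t) * (t ^ k / (k.factorial : ℝ))) • X₀
          + ∫ s in (0 : ℝ)..t,
              (Real.exp (-l * (t - s)) * ((t - s) ^ k / (k.factorial : ℝ))) • I s))
      (fun t : ℝ => ∑' k : ℕ,
        (W ^ k) ((Real.exp (-l * t) * (t ^ k / (k.factorial : ℝ))) • X₀
          + ∫ s in (0 : ℝ)..t,
              (Real.exp (-l * (t - s)) * ((t - s) ^ k / (k.factorial : ℝ))) • I s))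
      atTop (Set.Ici 0) := by
  have hIM : ∀ s, 0 ≤ s → ‖I s‖ ≤ M := fun s hs => by
    rw [hM]
    exact le_ciSup hI_bdd (⟨s, hs⟩ : Set.Ici (0 : ℝ))
  have key : ∀ (k : ℕ) (t : ℝ), 0 ≤ t →
      ‖(W ^ k) ((Real.exp (-l * t) * (t ^ k / (k.factorial : ℝ))) • X₀
          + ∫ s in (0 : ℝ)..t,
              (Real.exp (-l * (t - s)) * ((t - s) ^ k / (k.factorial : ℝ))) • I s)‖
        ≤ (‖W‖ / l) ^ k * (‖X₀‖ + M / l) := fun k t ht => by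
    refine (norm_pow_apply_le W k _).trans ?_
    have h1 : ‖(Real.exp (-l * t) * (t ^ k / (k.factorial : ℝ))) • X₀‖ ≤ 1 / l ^ k * ‖X₀‖ := by
      rw [norm_smul, Real.norm_of_nonneg (by positivity)]
      gcongr
      exact exp_neg_mul_pow_div_factorial_le hl ht k
    calc _ ≤ ‖W‖ ^ k * (1 / l ^ k * ‖X₀‖ + M / l ^ (k + 1)) := by
          gcongr
          exact (norm_add_le _ _).trans
            (add_le_add h1 (norm_integral_kernel_smul_le hIM hl ht k))
      _ = (‖W‖ / l) ^ k * (‖X₀‖ + M / l) := by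
          rw [div_pow, pow_succ]
          field_simp
  refine ⟨key, tendstoUniformlyOn_tsum_nat ?_ fun k t ht => key k t ht⟩
  exact (summable_geometric_of_lt_one (by positivity) ((div_lt_one hl).2 hWl)).mul_right _
end
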